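/- Fix an odd prime p and write M_s = M(λ(2s;(x_{(2s,0)}, x_{(s,0)}))) for the p^{(0)}-Fibonacci numbers (k = 0, r = s). Then for every s ≥ 2, M_{s+2} = p^{s−1}(p−1)(p²−1) + p·M_s + (p−1)·M_{s+1}. -/

import Mathlib

open Finset

namespace Bratteli

/-- `x_{(a,k)} = p^k (a·p - (a+1))` (the labels of the vertices of the p-Bratteli diagram). -/
def xv (p a k : ℕ) : ℕ := p ^ k * (a * p - (a + 1))

/-- `j^k_t = t · ∑_{i<k} p^i`. -/
def jkt (p k t : ℕ) : ℕ := t * ∑ i ∈ range k, p ^ i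

/-- base-`p` digits of `N`: a path of shape `λ(2r;(x_{(2s,k)},x_{(s,k)}+l))` is encoded by the
digit tuple `(t_0, …, t_{r-1})` of a number `N < p^r`. -/
def tDig (p N : ℕ) : ℕ → ℕ := fun i => N / p ^ i % p

/-- `α_j = ∑_{i=j}^{k+j-2} p^{i-j} t_i`. -/
def alphaF (p k : ℕ) (t : ℕ → ℕ) (j : ℕ) : ℕ := ∑ d ∈ range (k - 1), p ^ d * t (j + d)

/-- `i_j = ∑_{i=r-j}^{r-1} p^{i-(r-j)} t_i`. -/
def iIdx (p r : ℕ) (t : ℕ → ℕ) (j : ℕ) : ℕ := ∑ d ∈ range j, p ^ d * t (r - j + d)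

/-- vertical part `n_i` of the `i`-th block of the path encoded by `t`. -/
def nB (p k r : ℕ) (t : ℕ → ℕ) (i : ℕ) : ℕ :=
  if i % 2 = 1 then
    -- odd blocks `i = 2j+1`
    if i / 2 < k then 0 else p ^ k * (p - 1 - t (k + r - i / 2 - 1))
  else
    -- even blocks `i = 2j`
    if i / 2 ≤ k then (p - 1) * iIdx p r t (i / 2) + t (r - i / 2 - 1)
    else if k = 0 then t (r - i / 2 - 1)
    else (p - 1) * (alphaF p k t (r - i / 2) + p ^ (k - 1) * t (k + r - i / 2 - 1))
      + t (r - i / 2 - 1)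

/-- horizontal part `m_i` of the `i`-th block of the path encoded by `t`. -/
def mB (p k r : ℕ) (t : ℕ → ℕ) (i : ℕ) : ℕ :=
  if i % 2 = 1 then
    -- odd blocks `i = 2j+1`
    if i / 2 < k then 0 else p ^ k * t (k + r - i / 2 - 1)
  else
    -- even blocks `i = 2j`
    if i / 2 ≤ k then p ^ (k - 1) * (p - 1) ^ 2 - nB p k r t i
    else if k = 0 then p - 1 - t (r - i / 2 - 1)
    else p ^ k * (p - 1) - nB p k r t (i - 1)

/-- The path encoded by `t` has a descent at block `i`: at block `2k` exactly when
`t_{r-1} < (p-1)/2` (convention (c1)), and at a block `2k+2 ≤ i ≤ 2r-2` exactly when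
`m_i > m_{i+1}`; there is never a descent at block `2k+1` or below block `2k`. -/
def HasDescent (p k r : ℕ) (t : ℕ → ℕ) (i : ℕ) : Prop :=
  (i = 2 * k ∧ t (r - 1) < (p - 1) / 2) ∨
    (2 * k + 2 ≤ i ∧ i ≤ 2 * r - 2 ∧ mB p k r t (i + 1) < mB p k r t i)

instance (p k r : ℕ) (t : ℕ → ℕ) : DecidablePred (HasDescent p k r t) := fun i => by
  unfold HasDescent; infer_instance

/-- `des(P)`: the number of descents of the path encoded by `t`. -/
def desNum (p k r : ℕ) (t : ℕ → ℕ) : ℕ :=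
  ((range (2 * r - 1)).filter (HasDescent p k r t)).card

/-- `inv(P)`: the number of inversions of the path encoded by `t`; pairs `(i,j)` with
`2k+2 ≤ i < j ≤ 2r-1`, `m_i + n_i = m_j + n_j`, `m_i > m_j`, `n_i < n_j`, plus `1` exactly
when `t_{r-1} < (p-1)/2` (convention (c1) at block `2k`). -/
def invNum (p k r : ℕ) (t : ℕ → ℕ) : ℕ :=
  ((range (2 * r) ×ˢ range (2 * r)).filter fun q : ℕ × ℕ =>
      2 * k + 2 ≤ q.1 ∧ q.1 < q.2 ∧
        mB p k r t q.1 + nB p k r t q.1 = mB p k r t q.2 + nB p k r t q.2 ∧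
        mB p k r t q.2 < mB p k r t q.1 ∧ nB p k r t q.1 < nB p k r t q.2).card +
    if t (r - 1) < (p - 1) / 2 then 1 else 0

/-- `t` encodes a path of shape `λ(2r;(x_{(2s,k)},x_{(s,k)}+l))`. -/
def IsPath (p k r l : ℕ) (t : ℕ → ℕ) : Prop :=
  (∀ i, i ≤ r - 2 → t i ≤ p - 1) ∧ t (r - 1) ≤ p - 2 ∧ l = ∑ i ∈ range k, p ^ i * t i

/-- the finite set of all paths of shape `λ(2r;(x_{(2s,k)},x_{(s,k)}+l))`, encoded as the
numbers `N < p^r` whose base-`p` digits give the tuples `(t_0,…,t_{r-1})`. -/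
def pathFinset (p k r l : ℕ) : Finset ℕ :=
  (range (p ^ r)).filter fun N =>
    tDig p N (r - 1) ≤ p - 2 ∧ l = ∑ i ∈ range k, p ^ i * tDig p N i

/-- the `p^{(k)}`-Fibonacci number `𝓜(λ(2r;(x_{(2s,k)},x_{(s,k)}+l)))`:
the total number of descents over all paths of this shape. -/
def Mnum (p k r l : ℕ) : ℕ := ∑ N ∈ pathFinset p k r l, desNum p k r (tDig p N)

end Bratteli

namespace Bratteli

theorem sum_range_mul_eq_sum_sum (f : ℕ → ℕ) (p m : ℕ) :
    ∑ N ∈ range (p * m), f N = ∑ N ∈ range m, ∑ d ∈ range p, f (p * N + d) := by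
  induction m with
  | zero => simp
  | succ m ih => rw [Nat.mul_succ, Finset.sum_range_add, ih, Finset.sum_range_succ]

theorem tDig_mul_add_zero {p d : ℕ} (N : ℕ) (hd : d < p) : tDig p (p * N + d) 0 = d := by
  simp [tDig, Nat.mod_eq_of_lt hd]

theorem tDig_mul_add_succ {p d : ℕ} (N i : ℕ) (hd : d < p) :
    tDig p (p * N + d) (i + 1) = tDig p N i := by
  unfold tDig
  rw [pow_succ', ← Nat.div_div_eq_div_mul, Nat.mul_add_div (by omega), Nat.div_eq_of_lt hd,
    add_zero]

theorem mem_pathFinset_zero {p s N : ℕ} :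
    N ∈ pathFinset p 0 s 0 ↔ N < p ^ s ∧ tDig p N (s - 1) ≤ p - 2 := by
  simp [pathFinset]

theorem sum_pathFinset_succ (f : ℕ → ℕ) (p : ℕ) {s : ℕ} (hs : 1 ≤ s) :
    ∑ N ∈ pathFinset p 0 (s + 1) 0, f N =
      ∑ N ∈ pathFinset p 0 s 0, ∑ d ∈ range p, f (p * N + d) := by
  obtain ⟨s, rfl⟩ := Nat.exists_eq_add_of_le' hs
  simp only [pathFinset, range_zero, sum_empty, and_true, sum_filter, add_tsub_cancel_right]
  rw [pow_succ', sum_range_mul_eq_sum_sum]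
  refine sum_congr rfl fun N _ => ?_
  rw [sum_congr rfl fun d hd => by rw [tDig_mul_add_succ N s (mem_range.mp hd)]]
  split_ifs <;> simp

theorem card_pathFinset_zero {p s : ℕ} (hp : 2 ≤ p) (hs : 1 ≤ s) :
    (pathFinset p 0 s 0).card = (p - 1) * p ^ (s - 1) := by
  induction s, hs using Nat.le_induction with
  | base =>
    have : pathFinset p 0 1 0 = range (p - 1) := by
      ext N
      rw [mem_pathFinset_zero, mem_range, pow_one]
      constructor
      · rintro ⟨h, h'⟩
        simp only [tDig, tsub_self, pow_zero, Nat.div_one, Nat.mod_eq_of_lt h] at h'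
        omega
      · intro h
        simp only [tDig, tsub_self, pow_zero, Nat.div_one, Nat.mod_eq_of_lt (by omega : N < p)]
        omega
    simp [this]
  | succ s hs ih =>
    rw [card_eq_sum_ones, sum_pathFinset_succ _ _ hs]
    obtain ⟨s, rfl⟩ := Nat.exists_eq_add_of_le' hs
    simp only [sum_const, ih, card_range, smul_eq_mul, mul_one, add_tsub_cancel_right]
    ring

theorem hasDescent_zero_iff {p s i : ℕ} (t : ℕ → ℕ) :
    HasDescent p 0 s t i ↔ (i = 0 ∧ t (s - 1) < (p - 1) / 2) ∨
      (2 ≤ i ∧ i ≤ 2 * s - 2 ∧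
        if i % 2 = 1 then p - 1 - t (s - (i + 1) / 2 - 1) < t (s - i / 2 - 1)
        else t (s - i / 2 - 1) < p - 1 - t (s - i / 2 - 1)) := by
  unfold HasDescent
  refine or_congr (by simp) ?_
  simp only [mul_zero, zero_add]
  refine and_congr_right fun h2 => and_congr_right fun _ => ?_
  rcases Nat.mod_two_eq_zero_or_one i with h | h
  · have h1 : (i + 1) % 2 = 1 := by omega
    have h3 : (i + 1) / 2 = i / 2 := by omega
    have h4 : i / 2 ≠ 0 := by omega
    simp [mB, h, h1, h3, h4]
  · have h1 : (i + 1) % 2 = 0 := by omega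
    have h4 : (i + 1) / 2 ≠ 0 := by omega
    simp [mB, h, h1, h4]

/-- Appending a lowest digit `d` to a path adds two blocks, hence at most two descents. -/
theorem desNum_mul_add {p s d : ℕ} (N : ℕ) (hs : 2 ≤ s) (hd : d < p) :
    desNum p 0 (s + 1) (tDig p (p * N + d)) = desNum p 0 s (tDig p N) +
      (if p - 1 - d < N % p then 1 else 0) + (if d < p - 1 - d then 1 else 0) := by
  have hshift : ∀ j, j < s →
      tDig p (p * N + d) (s + 1 - j - 1) = tDig p N (s - j - 1) := fun j hj => by
    rw [show s + 1 - j - 1 = (s - j - 1) + 1 by omega, tDig_mul_add_succ _ _ hd]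
  have hlow : ∀ i ∈ range (2 * s - 1),
      (HasDescent p 0 (s + 1) (tDig p (p * N + d)) i ↔ HasDescent p 0 s (tDig p N) i) := by
    intro i hi
    rw [mem_range] at hi
    have h0 := hshift 0 (by omega)
    rw [Nat.sub_zero, Nat.sub_zero] at h0
    have hle : i ≤ 2 * (s + 1) - 2 ↔ i ≤ 2 * s - 2 := by omega
    rw [hasDescent_zero_iff, hasDescent_zero_iff, h0, hshift (i / 2) (by omega),
      hshift ((i + 1) / 2) (by omega), hle]
  have hlast : tDig p (p * N + d) (s + 1 - s - 1) = d := by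
    rw [show s + 1 - s - 1 = 0 by omega, tDig_mul_add_zero _ hd]
  have hprev : tDig p (p * N + d) (s + 1 - (s - 1) - 1) = N % p := by
    rw [hshift _ (by omega), show s - (s - 1) - 1 = 0 by omega]
    simp [tDig]
  have hodd : HasDescent p 0 (s + 1) (tDig p (p * N + d)) (2 * s - 1) ↔ p - 1 - d < N % p := by
    rw [hasDescent_zero_iff, show (2 * s - 1 + 1) / 2 = s by omega,
      show (2 * s - 1) / 2 = s - 1 by omega, hlast, hprev, if_pos (by omega)]
    omega
  have heven : HasDescent p 0 (s + 1) (tDig p (p * N + d)) (2 * s - 1 + 1) ↔ d < p - 1 - d := by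
    rw [hasDescent_zero_iff, show (2 * s - 1 + 1) / 2 = s by omega, hlast, if_neg (by omega)]
    omega
  unfold desNum
  rw [show 2 * (s + 1) - 1 = 2 * s - 1 + 1 + 1 by omega, card_filter, sum_range_succ,
    sum_range_succ, ← card_filter, filter_congr hlow]
  simp only [hodd, heven]

theorem sum_ite_sub_lt {p a : ℕ} (ha : a < p) :
    ∑ d ∈ range p, (if p - 1 - d < a then 1 else 0) = a := by
  rw [sum_range_reflect (fun d => if d < a then 1 else 0) p, ← card_filter,
    show (range p).filter (· < a) = range a by ext; simp; omega, card_range]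

theorem sum_ite_lt_sub (q : ℕ) :
    ∑ d ∈ range (2 * q + 1), (if d < 2 * q + 1 - 1 - d then 1 else 0) = q := by
  rw [← card_filter,
    show (range (2 * q + 1)).filter (fun d => d < 2 * q + 1 - 1 - d) = range q by
      ext; simp; omega, card_range]

theorem sum_mod_pathFinset {q s : ℕ} (hq : 1 ≤ q) (hs : 2 ≤ s) :
    ∑ N ∈ pathFinset (2 * q + 1) 0 s 0, N % (2 * q + 1) = 2 * q * q * (2 * q + 1) ^ (s - 1) := by
  obtain ⟨s, rfl⟩ := Nat.exists_eq_add_of_le' hs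
  have hmod : ∀ N, ∑ d ∈ range (2 * q + 1), ((2 * q + 1) * N + d) % (2 * q + 1) =
      (2 * q + 1) * q := fun N => by
    rw [sum_congr rfl fun d hd => by
      rw [Nat.mul_add_mod, Nat.mod_eq_of_lt (mem_range.mp hd)], sum_range_id,
      add_tsub_cancel_right, mul_comm 2 q, ← mul_assoc, Nat.mul_div_cancel _ two_pos]
  rw [sum_pathFinset_succ _ _ (by omega : 1 ≤ s + 1)]
  simp only [hmod, sum_const, smul_eq_mul]
  rw [card_pathFinset_zero (by omega) (by omega)]
  simp only [add_tsub_cancel_right, show s + 2 - 1 = s + 1 by omega]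
  ring

theorem Mnum_zero_succ {q s : ℕ} (hq : 1 ≤ q) (hs : 2 ≤ s) :
    Mnum (2 * q + 1) 0 (s + 1) 0 =
      (2 * q + 1) * Mnum (2 * q + 1) 0 s 0 + (2 * q) ^ 2 * (2 * q + 1) ^ (s - 1) := by
  have hsum : ∀ N, ∑ d ∈ range (2 * q + 1),
      desNum (2 * q + 1) 0 (s + 1) (tDig (2 * q + 1) ((2 * q + 1) * N + d)) =
        (2 * q + 1) * desNum (2 * q + 1) 0 s (tDig (2 * q + 1) N) + N % (2 * q + 1) + q :=
    fun N => by
      rw [sum_congr rfl fun d hd => desNum_mul_add N hs (mem_range.mp hd), sum_add_distrib,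
        sum_add_distrib, sum_ite_sub_lt (Nat.mod_lt _ (by omega)), sum_ite_lt_sub]
      simp
  unfold Mnum
  rw [sum_pathFinset_succ _ _ (by omega)]
  simp only [hsum, sum_add_distrib, ← mul_sum, sum_const, smul_eq_mul]
  rw [sum_mod_pathFinset hq hs, card_pathFinset_zero (by omega) (by omega),
    add_tsub_cancel_right]
  ring

end Bratteli

open Bratteli
/-- the Fibonacci-type recurrence for the `p^{(0)}`-Fibonacci numbers. -/
theorem p0_fibonacci_recurrence (p : ℕ) (hp : Nat.Prime p) (hodd : Odd p) :
    ∀ s : ℕ, 2 ≤ s →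
      Mnum p 0 (s + 2) 0 = p ^ (s - 1) * (p - 1) * (p ^ 2 - 1)
        + p * Mnum p 0 s 0 + (p - 1) * Mnum p 0 (s + 1) 0 := by
  intro s hs
  obtain ⟨q, rfl⟩ := hodd
  have hq : 1 ≤ q := by have := hp.two_le; omega
  rw [Mnum_zero_succ hq (by omega : 2 ≤ s + 1), Mnum_zero_succ hq hs]
  obtain ⟨s, rfl⟩ := Nat.exists_eq_add_of_le' hs
  rw [show (2 * q + 1) ^ 2 - 1 = 2 * q * (2 * q + 2) by
    rw [Nat.sub_eq_iff_eq_add (Nat.one_le_pow _ _ (by omega))]; ring]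
  simp only [add_tsub_cancel_right, show s + 2 - 1 = s + 1 by omega]
  ring
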